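/- Every orthomodular lattice L can be embedded into a Boolean saturated orthomodular lattice: there exist a Boolean saturated orthomodular lattice L^◇ and an injective map e : L → L^◇ preserving ∧, ∨, ¬, 0 and 1. -/

import Mathlib

/-! Basic notions: orthomodular lattices, central elements, Boolean saturation,
modal extensions and possibility spaces. -/

/-- An orthomodular lattice: a bounded lattice with an involution `neg`
satisfying `x ⊓ neg x = ⊥` and the orthomodular law. -/
class OML (α : Type u) extends Lattice α, BoundedOrder α where
  neg : α → α
  neg_neg : ∀ x : α, neg (neg x) = x
  neg_sup : ∀ x y : α, neg (x ⊔ y) = neg x ⊓ neg y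
  inf_neg : ∀ x : α, x ⊓ neg x = ⊥
  orthomodular : ∀ x y : α, x ⊔ (neg x ⊓ (x ⊔ y)) = x ⊔ y

namespace OML

variable {α : Type u} [OML α]

/-- `(a,b,c)D` -/
def D (a b c : α) : Prop := (a ⊔ b) ⊓ c = (a ⊓ c) ⊔ (b ⊓ c)

/-- `(a,b,c)D*` -/
def Dstar (a b c : α) : Prop := (a ⊓ b) ⊔ c = (a ⊔ c) ⊓ (b ⊔ c)

/-- A central element: complemented and all permuted distributivity
conditions hold. -/
def IsCentral (z : α) : Prop :=
  (∃ c : α, z ⊓ c = ⊥ ∧ z ⊔ c = ⊤) ∧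
    ∀ a b : α, D a b z ∧ D a z b ∧ D z a b ∧ Dstar a b z ∧ Dstar a z b ∧ Dstar z a b

end OML

/-- `dia` is the possibility operator: `dia a` is the least central element above `a`. -/
def IsDiamond {α : Type u} [OML α] (dia : α → α) : Prop :=
  ∀ a : α, IsLeast {z : α | OML.IsCentral z ∧ a ≤ z} (dia a)

/-- A Boolean saturated orthomodular lattice: every `{z ∈ Z(L) : a ≤ z}` has a minimum. -/
def BooleanSaturated (α : Type u) [OML α] : Prop :=
  ∀ a : α, ∃ m : α, IsLeast {z : α | OML.IsCentral z ∧ a ≤ z} m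

/-- A Boolean sublattice: a sublattice containing `⊥, ⊤`, closed under `neg`,
and distributive. -/
structure IsBooleanSub {α : Type u} [OML α] (S : Set α) : Prop where
  bot_mem : (⊥ : α) ∈ S
  top_mem : (⊤ : α) ∈ S
  inf_mem : ∀ x ∈ S, ∀ y ∈ S, x ⊓ y ∈ S
  sup_mem : ∀ x ∈ S, ∀ y ∈ S, x ⊔ y ∈ S
  neg_mem : ∀ x ∈ S, OML.neg x ∈ S
  distrib : ∀ x ∈ S, ∀ y ∈ S, ∀ z ∈ S, x ⊓ (y ⊔ z) = (x ⊓ y) ⊔ (x ⊓ z)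

/-- A Boolean homomorphism into the two-element Boolean algebra `Bool`,
defined on the subset `S`. -/
def IsBoolHomOn {α : Type u} [OML α] (S : Set α) (v : α → Bool) : Prop :=
  v ⊥ = false ∧ v ⊤ = true ∧
    (∀ x ∈ S, ∀ y ∈ S, v (x ⊓ y) = (v x && v y)) ∧
    (∀ x ∈ S, ∀ y ∈ S, v (x ⊔ y) = (v x || v y)) ∧
    (∀ x ∈ S, v (OML.neg x) = !(v x))

/-- Membership in the sublattice generated by `X`. -/
inductive GenSub {α : Type u} [OML α] (X : Set α) : α → Prop
  | base : ∀ x ∈ X, GenSub X x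
  | inf : ∀ x y, GenSub X x → GenSub X y → GenSub X (x ⊓ y)
  | sup : ∀ x y, GenSub X x → GenSub X y → GenSub X (x ⊔ y)

/-- The embedding of a modal extension: injective and preserving `⊓, ⊔, neg, ⊥, ⊤`. -/
def IsOMLEmbedding {α : Type u} {β : Type v} [OML α] [OML β] (e : α → β) : Prop :=
  Function.Injective e ∧ e ⊥ = ⊥ ∧ e ⊤ = ⊤ ∧
    (∀ x y : α, e (x ⊓ y) = e x ⊓ e y) ∧
    (∀ x y : α, e (x ⊔ y) = e x ⊔ e y) ∧
    (∀ x : α, e (OML.neg x) = OML.neg (e x))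

/-- The possibility space `◇L`: the sublattice of `L^◇` generated by `{◇p : p ∈ L}`. -/
def PossSpace {α : Type u} {β : Type v} [OML α] [OML β] (e : α → β) (dia : β → β) : Set β :=
  {x : β | GenSub (Set.range fun p : α => dia (e p)) x}

/-- A global valuation: a compatible family of Boolean homomorphisms into `2`,
indexed by the Boolean sublattices. -/
def HasGlobalValuation (α : Type u) [OML α] : Prop :=
  ∃ v : Set α → α → Bool,
    (∀ W : Set α, IsBooleanSub W → IsBoolHomOn W (v W)) ∧
    (∀ W W' : Set α, IsBooleanSub W → IsBooleanSub W' → ∀ x ∈ W ∩ W', v W x = v W' x)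
/-- A Boolean saturated orthomodular lattice together with an embedding of `α`
into it (a modal extension of `α`). -/
structure SaturatedExtension (α : Type u) [OML α] : Type (u + 1) where
  carrier : Type u
  [inst : OML carrier]
  saturated : BooleanSaturated carrier
  e : α → carrier
  embedding : IsOMLEmbedding e

namespace OML

variable {α : Type u} [OML α]

theorem neg_top : neg (⊤ : α) = ⊥ := by
  simpa using inf_neg (⊤ : α)

theorem neg_bot : neg (⊥ : α) = ⊤ := by
  rw [← neg_top, neg_neg]

theorem neg_eq_top_iff {a : α} : neg a = ⊤ ↔ a = ⊥ :=
  ⟨fun h => by rw [← neg_neg a, h, neg_top], fun h => by rw [h, neg_bot]⟩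

theorem sup_neg (a : α) : a ⊔ neg a = ⊤ := by
  simpa using orthomodular a ⊤

theorem isCentral_bot : IsCentral (⊥ : α) := by
  refine ⟨⟨⊤, by simp, by simp⟩, fun a b => ?_⟩
  simp [D, Dstar]

theorem isCentral_top : IsCentral (⊤ : α) := by
  refine ⟨⟨⊥, by simp, by simp⟩, fun a b => ?_⟩
  simp [D, Dstar]

end OML

/-- An orthomodular lattice with trivial centre is Boolean saturated. -/
theorem BooleanSaturated.of_isCentral_eq {α : Type u} [OML α]
    (h : ∀ z : α, OML.IsCentral z → z = ⊥ ∨ z = ⊤) : BooleanSaturated α := by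
  intro a
  by_cases ha : a = ⊥
  · exact ⟨⊥, ⟨OML.isCentral_bot, ha.le⟩, fun _ _ => bot_le⟩
  · refine ⟨⊤, ⟨OML.isCentral_top, le_top⟩, fun z hz => ?_⟩
    rcases h z hz.1 with rfl | rfl
    · exact absurd (le_bot_iff.mp hz.2) ha
    · exact le_rfl

theorem BooleanSaturated.of_subsingleton {α : Type u} [OML α] [Subsingleton α] :
    BooleanSaturated α :=
  .of_isCentral_eq fun _ _ => .inl (Subsingleton.elim _ _)

/-- The horizontal sum of `α` with the six-element orthomodular lattice `MO₂`: four atoms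
are added to `α`, pairwise joining to `⊤` and meeting to `⊥`. -/
inductive HSum (α : Type u) : Type u
  | base (a : α)
  | atom (i s : Bool)

namespace HSum

variable {α : Type u} [OML α]

/-- The order of the horizontal sum. -/
protected def le : HSum α → HSum α → Prop
  | base a, base b => a ≤ b
  | base a, atom _ _ => a = ⊥
  | atom _ _, base b => b = ⊤
  | atom i s, atom j t => i = j ∧ s = t

open Classical in
/-- The join of the horizontal sum. -/
protected noncomputable def sup : HSum α → HSum α → HSum α
  | base a, base b => base (a ⊔ b)
  | base a, atom i s => if a = ⊥ then atom i s else base ⊤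
  | atom i s, base b => if b = ⊥ then atom i s else base ⊤
  | atom i s, atom j t => if i = j ∧ s = t then atom i s else base ⊤

open Classical in
/-- The meet of the horizontal sum. -/
protected noncomputable def inf : HSum α → HSum α → HSum α
  | base a, base b => base (a ⊓ b)
  | base a, atom i s => if a = ⊤ then atom i s else base ⊥
  | atom i s, base b => if b = ⊤ then atom i s else base ⊥
  | atom i s, atom j t => if i = j ∧ s = t then atom i s else base ⊥

/-- The orthocomplement of the horizontal sum. -/
protected def neg : HSum α → HSum α
  | base a => base (OML.neg a)
  | atom i s => atom i (!s)

variable [Nontrivial α]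

noncomputable instance : Lattice (HSum α) where
  le := HSum.le
  sup := HSum.sup
  inf := HSum.inf
  le_refl x := by cases x <;> simp [HSum.le]
  le_trans x y z := by
    have := bot_ne_top (α := α)
    rcases x with x | _ <;> rcases y with y | _ <;> rcases z with z | _ <;>
      simp only [HSum.le] <;> grind [le_trans, le_bot_iff, top_le_iff, bot_le, le_top]
  le_antisymm x y := by
    have := bot_ne_top (α := α)
    rcases x with x | _ <;> rcases y with y | _ <;>
      simp only [HSum.le] <;> grind [le_antisymm]
  le_sup_left x y := by
    rcases x with x | _ <;> rcases y with y | _ <;> simp only [HSum.sup] <;>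
      (try split_ifs) <;> simp_all [HSum.le]
  le_sup_right x y := by
    rcases x with x | _ <;> rcases y with y | _ <;> simp only [HSum.sup] <;>
      (try split_ifs) <;> simp_all [HSum.le]
  sup_le x y z := by
    have := bot_ne_top (α := α)
    rcases x with x | _ <;> rcases y with y | _ <;> rcases z with z | _ <;>
      simp only [HSum.sup] <;> (try split_ifs) <;> simp_all [HSum.le] <;> grind
  inf_le_left x y := by
    rcases x with x | _ <;> rcases y with y | _ <;> simp only [HSum.inf] <;>
      (try split_ifs) <;> simp_all [HSum.le]
  inf_le_right x y := by
    rcases x with x | _ <;> rcases y with y | _ <;> simp only [HSum.inf] <;>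
      (try split_ifs) <;> simp_all [HSum.le]
  le_inf x y z := by
    have := bot_ne_top (α := α)
    rcases x with x | _ <;> rcases y with y | _ <;> rcases z with z | _ <;>
      simp only [HSum.inf] <;> (try split_ifs) <;> simp_all [HSum.le]

instance : BoundedOrder (HSum α) where
  bot := base ⊥
  top := base ⊤
  bot_le x := by cases x <;> simp [LE.le, HSum.le]
  le_top x := by cases x <;> simp [LE.le, HSum.le]

theorem bot_def : (⊥ : HSum α) = base ⊥ := rfl

theorem top_def : (⊤ : HSum α) = base ⊤ := rfl

theorem sup_def (x y : HSum α) : x ⊔ y = HSum.sup x y := rfl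

theorem inf_def (x y : HSum α) : x ⊓ y = HSum.inf x y := rfl

noncomputable instance : OML (HSum α) where
  neg := HSum.neg
  neg_neg x := by cases x <;> simp [HSum.neg, OML.neg_neg]
  neg_sup x y := by
    simp only [sup_def, inf_def]
    rcases x with x | _ <;> rcases y with y | _ <;> simp only [HSum.sup, HSum.neg, HSum.inf] <;>
      (try split_ifs) <;> simp_all [OML.neg_sup, OML.neg_top, OML.neg_eq_top_iff]
  inf_neg x := by
    simp only [inf_def, bot_def]
    cases x <;> simp [HSum.neg, HSum.inf, OML.inf_neg]
  orthomodular x y := by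
    have := bot_ne_top (α := α)
    simp only [sup_def, inf_def]
    rcases x with x | _ <;> rcases y with y | _ <;> simp only [HSum.sup, HSum.neg, HSum.inf] <;>
      (try split_ifs) <;>
      simp_all [OML.orthomodular, OML.neg_bot, OML.sup_neg]

theorem eq_bot_or_eq_top_of_isCentral {z : HSum α} (hz : OML.IsCentral z) :
    z = ⊥ ∨ z = ⊤ := by
  have := bot_ne_top (α := α)
  simp only [bot_def, top_def]
  rcases z with a | ⟨i, s⟩
  · have h := (hz.2 (atom true true) (atom true false)).1
    simp only [OML.D, sup_def, inf_def, HSum.sup, HSum.inf] at h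
    by_cases ha : a = ⊤ <;> simp_all
  · have h := (hz.2 (atom (!i) true) (atom (!i) false)).1
    simp_all [OML.D, sup_def, inf_def, HSum.sup, HSum.inf]

theorem booleanSaturated : BooleanSaturated (HSum α) :=
  .of_isCentral_eq fun _ => eq_bot_or_eq_top_of_isCentral

theorem isOMLEmbedding_base : IsOMLEmbedding (base : α → HSum α) :=
  ⟨fun _ _ h => HSum.base.inj h, rfl, rfl, fun _ _ => rfl, fun _ _ => rfl, fun _ => rfl⟩

end HSum

/-- Every orthomodular lattice can be embedded into a Boolean
saturated orthomodular lattice by an injective map preserving `⊓, ⊔, ¬, ⊥, ⊤`. -/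
theorem exists_saturated_extension (α : Type u) [OML α] :
    Nonempty (SaturatedExtension α) := by
  rcases subsingleton_or_nontrivial α with _ | _
  · exact ⟨⟨α, BooleanSaturated.of_subsingleton, id, Function.injective_id, rfl, rfl,
      fun _ _ => rfl, fun _ _ => rfl, fun _ => rfl⟩⟩
  · exact ⟨⟨HSum α, HSum.booleanSaturated, HSum.base, HSum.isOMLEmbedding_base⟩⟩
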